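/- arXiv:2411.10235 — 2 statements merged into one kernel-verified Lean document; each statement's English description precedes it below -/
import Mathlib

section
/- Under the same assumptions ($p^{t,x} \le M \varphi^{t,x}$ pointwise for some constant $M$), for all coordinates $i,j$: $\int \left(H(y,x)_i H(y,x)_j - \int H(z,x)_i H(z,x)_j \, p^{t,x}(z)\,dz\right)^2 p^{t,x}(y)\, dy \le C(1-t^2)^2$, where $C$ depends only on $M$ and $d$. -/
open MeasureTheory Real Set

lemma aux_gauss_int {d : ℕ} {b : ℝ} (hb : 0 < b) :
    Integrable (fun v : EuclideanSpace ℝ (Fin d) => Real.exp (-b * ‖v‖ ^ 2)) := by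
  have h := GaussianFourier.integrable_cexp_neg_mul_sq_norm_add (V := EuclideanSpace ℝ (Fin d))
    (b := (b : ℂ)) (by simpa using hb) 0 0
  have h2 := h.norm
  refine h2.congr (Filter.Eventually.of_forall fun v => ?_)
  simp only [Complex.norm_exp]
  congr 1
  simp [← Complex.ofReal_pow]

lemma aux_u4 (u s : ℝ) (hs : 0 < s) :
    u ^ 4 * Real.exp (-u ^ 2 / (2 * s)) ≤ 32 * s ^ 2 * Real.exp (-(1 / (4 * s)) * u ^ 2) := by
  have h1 := Real.quadratic_le_exp_of_nonneg (x := u ^ 2 / (4 * s)) (by positivity)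
  have h2 : (u ^ 2 / (4 * s)) ^ 2 / 2 ≤ Real.exp (u ^ 2 / (4 * s)) := by
    have : 0 ≤ u ^ 2 / (4 * s) := by positivity
    linarith
  have h3 : u ^ 4 ≤ 32 * s ^ 2 * Real.exp (u ^ 2 / (4 * s)) := by
    have e : u ^ 4 = 32 * s ^ 2 * ((u ^ 2 / (4 * s)) ^ 2 / 2) := by
      field_simp; ring
    rw [e]; gcongr
  calc u ^ 4 * Real.exp (-u ^ 2 / (2 * s))
      ≤ 32 * s ^ 2 * Real.exp (u ^ 2 / (4 * s)) * Real.exp (-u ^ 2 / (2 * s)) := by gcongr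
    _ = _ := by
      rw [mul_assoc, ← Real.exp_add]
      congr 2
      field_simp; ring

lemma aux_moment {d : ℕ} (M : ℝ) (hM : 0 < M) (s : ℝ) (hs : 0 < s)
    (m : EuclideanSpace ℝ (Fin d)) (p : EuclideanSpace ℝ (Fin d) → ℝ)
    (hp0 : ∀ y, 0 ≤ p y) (hpi : Integrable p)
    (hp : ∀ y, p y ≤ M * ((2 * π * s) ^ (-(d : ℝ) / 2) *
          Real.exp (-‖y - m‖ ^ 2 / (2 * s)))) :
    Integrable (fun y => ‖y - m‖ ^ 4 * p y) ∧
      ∫ y, ‖y - m‖ ^ 4 * p y ≤ M * (32 * 2 ^ ((d : ℝ) / 2)) * s ^ 2 := by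
  have hb : 0 < 1 / (4 * s) := by positivity
  set c : ℝ := M * (2 * π * s) ^ (-(d : ℝ) / 2) * (32 * s ^ 2) with hc
  have hbound : ∀ y, ‖y - m‖ ^ 4 * p y ≤ c * Real.exp (-(1 / (4 * s)) * ‖y - m‖ ^ 2) := by
    intro y
    calc ‖y - m‖ ^ 4 * p y ≤ ‖y - m‖ ^ 4 * (M * ((2 * π * s) ^ (-(d : ℝ) / 2) *
          Real.exp (-‖y - m‖ ^ 2 / (2 * s)))) := by gcongr; exact hp y
      _ = M * (2 * π * s) ^ (-(d : ℝ) / 2) *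
          (‖y - m‖ ^ 4 * Real.exp (-‖y - m‖ ^ 2 / (2 * s))) := by ring
      _ ≤ M * (2 * π * s) ^ (-(d : ℝ) / 2) *
          (32 * s ^ 2 * Real.exp (-(1 / (4 * s)) * ‖y - m‖ ^ 2)) := by
            exact mul_le_mul_of_nonneg_left (aux_u4 _ _ hs) (by positivity)
      _ = _ := by rw [hc]; ring
  have hgi : Integrable (fun y : EuclideanSpace ℝ (Fin d) =>
      c * Real.exp (-(1 / (4 * s)) * ‖y - m‖ ^ 2)) :=
    ((aux_gauss_int hb).comp_sub_right m).const_mul c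
  have hint : Integrable (fun y => ‖y - m‖ ^ 4 * p y) := by
    refine hgi.mono' ?_ (Filter.Eventually.of_forall fun y => ?_)
    · exact (Continuous.aestronglyMeasurable (by fun_prop)).mul hpi.1
    · rw [Real.norm_of_nonneg (mul_nonneg (by positivity) (hp0 y))]
      exact hbound y
  refine ⟨hint, (integral_mono hint hgi hbound).trans (le_of_eq ?_)⟩
  rw [integral_const_mul,
    integral_sub_right_eq_self
      (fun y : EuclideanSpace ℝ (Fin d) => Real.exp (-(1 / (4 * s)) * ‖y‖ ^ 2)) m,
    GaussianFourier.integral_rexp_neg_mul_sq_norm hb, finrank_euclideanSpace_fin]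
  have e : π / (1 / (4 * s)) = 2 * (2 * π * s) := by field_simp; ring
  rw [e, Real.mul_rpow (by norm_num) (by positivity), hc]
  have e2 : (2 * π * s) ^ (-(d : ℝ) / 2) * (2 * π * s) ^ ((d : ℝ) / 2) = 1 := by
    rw [← Real.rpow_add (by positivity)]
    rw [show -(d : ℝ) / 2 + (d : ℝ) / 2 = 0 by ring, Real.rpow_zero]
  linear_combination (M * 32 * s ^ 2 * 2 ^ ((d : ℝ) / 2)) * e2

/-- variance of the recentered second moments of the tilted Gaussian
family is at most `C (1 - t²)²`, with `C` depending only on `M` and `d`. -/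
theorem stmt_8 (M : ℝ) (hM : 0 < M) (d : ℕ) :
    ∃ C > 0, ∀ (t : ℝ), t ∈ Ioo (0 : ℝ) 1 →
      ∀ (x : EuclideanSpace ℝ (Fin d))
        (φ ptx : EuclideanSpace ℝ (Fin d) → ℝ)
        (H : EuclideanSpace ℝ (Fin d) → EuclideanSpace ℝ (Fin d)),
        (∀ y, φ y = (2 * π * (1 - t ^ 2)) ^ (-(d : ℝ) / 2) *
          Real.exp (-‖y - t • x‖ ^ 2 / (2 * (1 - t ^ 2)))) →
        (∀ y, 0 ≤ ptx y) → (∫ y, ptx y = 1) →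
        (∀ y, ptx y ≤ M * φ y) →
        (∀ y, H y = y - ∫ z, ptx z • z) →
        ∀ i j : Fin d,
          ∫ y, (H y i * H y j - ∫ z, (H z i * H z j) * ptx z) ^ 2 * ptx y
            ≤ C * (1 - t ^ 2) ^ 2 := by
  set B : ℝ := M * (32 * 2 ^ ((d : ℝ) / 2)) with hB
  have hB0 : 0 < B := by positivity
  refine ⟨8 * (B + (1 + B) ^ 4), by positivity, ?_⟩
  intro t ht x φ p H hφ hp0 hp1 hpφ hH i j
  have hs : 0 < 1 - t ^ 2 := by nlinarith [ht.1, ht.2]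
  set s := 1 - t ^ 2 with hsdef
  set m := t • x with hm
  have hpi : Integrable p := by
    by_contra h
    rw [integral_undef h] at hp1
    norm_num at hp1
  obtain ⟨h4i, h4⟩ := aux_moment M hM s hs m p hp0 hpi (fun y => by rw [← hφ y]; exact hpφ y)
  rw [← hB] at h4
  set a := ∫ z, p z • z with ha
  set r := Real.sqrt s with hr
  have hr0 : 0 < r := Real.sqrt_pos.2 hs
  have hr2 : r ^ 2 = s := Real.sq_sqrt hs.le
  -- first moment
  have hu : ∀ u : ℝ, 0 ≤ u → u ≤ r + u ^ 4 / r ^ 3 := by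
    intro u hu0
    rcases le_total u r with h | h
    · have : 0 ≤ u ^ 4 / r ^ 3 := by positivity
      linarith
    · have : u ≤ u ^ 4 / r ^ 3 := by
        rw [le_div_iff₀ (by positivity)]
        calc u * r ^ 3 ≤ u * u ^ 3 := by gcongr
          _ = u ^ 4 := by ring
      linarith
  have hgi : Integrable (fun y => r * p y + (1 / r ^ 3) * (‖y - m‖ ^ 4 * p y)) :=
    (hpi.const_mul r).add (h4i.const_mul _)
  have hle1 : ∀ y, ‖y - m‖ * p y ≤ r * p y + (1 / r ^ 3) * (‖y - m‖ ^ 4 * p y) := by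
    intro y
    have := mul_le_mul_of_nonneg_right (hu _ (norm_nonneg (y - m))) (hp0 y)
    calc _ ≤ _ := this
      _ = _ := by ring
  have hn : ∀ y, ‖p y • (y - m)‖ = ‖y - m‖ * p y := by
    intro y
    rw [norm_smul, Real.norm_of_nonneg (hp0 y), mul_comm]
  have h1i : Integrable (fun y => p y • (y - m)) := by
    refine hgi.mono' ?_ (Filter.Eventually.of_forall fun y => ?_)
    · exact hpi.1.smul (Continuous.aestronglyMeasurable (by fun_prop))
    · rw [hn]; exact hle1 y
  have ham : a - m = ∫ y, p y • (y - m) := by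
    have e : (fun z => p z • z) = fun z => p z • (z - m) + p z • m := by
      funext z; rw [← smul_add, sub_add_cancel]
    rw [ha, e, integral_add h1i (hpi.smul_const m), integral_smul_const, hp1, one_smul,
      add_sub_cancel_right]
  have han : ‖a - m‖ ≤ r * (1 + B) := by
    calc ‖a - m‖ ≤ ∫ y, ‖p y • (y - m)‖ := by rw [ham]; exact norm_integral_le_integral_norm _
      _ ≤ ∫ y, (r * p y + (1 / r ^ 3) * (‖y - m‖ ^ 4 * p y)) :=
        integral_mono h1i.norm hgi (fun y => by simpa only [hn] using hle1 y)
      _ = r + (1 / r ^ 3) * ∫ y, ‖y - m‖ ^ 4 * p y := by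
        rw [integral_add (hpi.const_mul r) (h4i.const_mul _), integral_const_mul,
          integral_const_mul, hp1, mul_one]
      _ ≤ r + (1 / r ^ 3) * (B * s ^ 2) := by gcongr
      _ = r * (1 + B) := by rw [← hr2]; field_simp
  have ha4 : ‖a - m‖ ^ 4 ≤ s ^ 2 * (1 + B) ^ 4 := by
    calc ‖a - m‖ ^ 4 ≤ (r * (1 + B)) ^ 4 := by gcongr
      _ = _ := by rw [← hr2]; ring
  -- second moments
  set f : EuclideanSpace ℝ (Fin d) → ℝ := fun y => H y i * H y j with hf
  have hHc : Continuous H := by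
    rw [show H = fun y => y - a from funext hH]; fun_prop
  have hfc : Continuous f := by
    rw [hf]; fun_prop
  have hf2 : ∀ y, f y ^ 2 ≤ 8 * (‖y - m‖ ^ 4 + s ^ 2 * (1 + B) ^ 4) := by
    intro y
    have hi : |H y i| ≤ ‖H y‖ := by simpa using PiLp.norm_apply_le (H y) i
    have hj : |H y j| ≤ ‖H y‖ := by simpa using PiLp.norm_apply_le (H y) j
    have hHy : ‖H y‖ ≤ ‖y - m‖ + ‖a - m‖ := by
      rw [hH, show y - a = (y - m) - (a - m) by abel]; exact norm_sub_le _ _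
    calc f y ^ 2 = |H y i| ^ 2 * |H y j| ^ 2 := by rw [sq_abs, sq_abs, hf]; ring
      _ ≤ ‖H y‖ ^ 2 * ‖H y‖ ^ 2 := by gcongr
      _ = ‖H y‖ ^ 4 := by ring
      _ ≤ (‖y - m‖ + ‖a - m‖) ^ 4 := by gcongr
      _ ≤ 2 ^ 3 * (‖y - m‖ ^ 4 + ‖a - m‖ ^ 4) :=
        add_pow_le (norm_nonneg _) (norm_nonneg _) 4
      _ ≤ _ := by norm_num; linarith
  have hGi : Integrable (fun y => 8 * (‖y - m‖ ^ 4 * p y) + 8 * (s ^ 2 * (1 + B) ^ 4) * p y) :=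
    (h4i.const_mul 8).add (hpi.const_mul _)
  have hf2p : ∀ y, f y ^ 2 * p y ≤ 8 * (‖y - m‖ ^ 4 * p y) + 8 * (s ^ 2 * (1 + B) ^ 4) * p y := by
    intro y
    calc _ ≤ _ := mul_le_mul_of_nonneg_right (hf2 y) (hp0 y)
      _ = _ := by ring
  have hf2i : Integrable (fun y => f y ^ 2 * p y) := by
    refine hGi.mono' ?_ (Filter.Eventually.of_forall fun y => ?_)
    · exact ((hfc.pow 2).aestronglyMeasurable).mul hpi.1
    · rw [Real.norm_of_nonneg (mul_nonneg (by positivity) (hp0 y))]; exact hf2p y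
  have hfi : Integrable (fun y => f y * p y) := by
    refine (hf2i.add hpi).mono' (hfc.aestronglyMeasurable.mul hpi.1)
      (Filter.Eventually.of_forall fun y => ?_)
    rw [norm_mul, Real.norm_of_nonneg (hp0 y), Real.norm_eq_abs]
    have h : |f y| ≤ f y ^ 2 + 1 := by
      rw [← sq_abs]; nlinarith [sq_nonneg (|f y| - 1), abs_nonneg (f y)]
    calc _ ≤ _ := mul_le_mul_of_nonneg_right h (hp0 y)
      _ = _ := by simp only [Pi.add_apply]; ring
  change ∫ y, (f y - ∫ z, f z * p z) ^ 2 * p y ≤ _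
  set K := ∫ z, f z * p z with hK
  have e : (fun y => (f y - K) ^ 2 * p y)
      = fun y => (f y ^ 2 * p y - 2 * K * (f y * p y)) + K ^ 2 * p y := by
    funext y; ring
  have hsubi : Integrable (fun y => f y ^ 2 * p y - 2 * K * (f y * p y)) :=
    hf2i.sub (hfi.const_mul _)
  rw [e, integral_add hsubi (hpi.const_mul _),
    integral_sub hf2i (hfi.const_mul _), integral_const_mul, integral_const_mul, hp1, ← hK]
  have hfin : ∫ y, f y ^ 2 * p y ≤ 8 * (B * s ^ 2) + 8 * (s ^ 2 * (1 + B) ^ 4) := by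
    calc _ ≤ _ := integral_mono hf2i hGi hf2p
      _ = 8 * (∫ y, ‖y - m‖ ^ 4 * p y) + 8 * (s ^ 2 * (1 + B) ^ 4) := by
        rw [integral_add (h4i.const_mul 8) (hpi.const_mul _), integral_const_mul,
          integral_const_mul, hp1, mul_one]
      _ ≤ _ := by gcongr
  nlinarith [sq_nonneg K]
end

section
/- Let $a \in \mathcal{H}^{\delta,\theta}$, i.e. $|a(x) - a(y)| \le K \|x-y\|^{\delta} \log\big((\|x-y\|\wedge \tfrac12)^{-1}\big)^{-\theta}$ for all $x,y$, with $\delta \in (0,1]$, $\theta > 0$, $\|a\|_\infty \le K$, and let $r = e^a$. Let $\varphi^{t,x}$ be the Gaussian density with mean $tx$ and covariance $(1-t^2)\mathrm{Id}$. Then $\Big\|\int (y - tx)\big(r(y) - r(tx)\big)\varphi^{t,x}(y)\, dy\Big\|^2 \le C (1-t^2)^{1+\delta} \log\big(((1-t^2)\wedge \tfrac12)^{-1}\big)^{-2\theta}$ for a constant $C$ depending only on $K$, $d$, $\delta$, $\theta$. -/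
open MeasureTheory Real Set

lemma aux_exp (K a b : ℝ) (ha : a ≤ K) (hb : b ≤ K) :
    |exp a - exp b| ≤ exp K * |a - b| := by
  have key : ∀ p q : ℝ, p ≤ K → q ≤ p → exp p - exp q ≤ exp K * (p - q) := by
    intro p q hp hqp
    have h1 : exp q = exp p * exp (q - p) := by rw [← exp_add]; ring_nf
    have h2 := add_one_le_exp (q - p)
    have h3 := exp_le_exp.2 hp
    have h4 := exp_pos p
    calc exp p - exp q = exp p * (1 - exp (q - p)) := by rw [h1]; ring
      _ ≤ exp p * (p - q) := mul_le_mul_of_nonneg_left (by linarith) h4.le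
      _ ≤ exp K * (p - q) := by
        have : 0 ≤ p - q := by linarith
        gcongr
  rcases le_total a b with h | h
  · rw [abs_sub_comm, abs_sub_comm a b, abs_of_nonneg (sub_nonneg.2 (exp_le_exp.2 h)),
      abs_of_nonneg (sub_nonneg.2 h)]
    exact key b a hb h
  · rw [abs_of_nonneg (sub_nonneg.2 (exp_le_exp.2 h)),
      abs_of_nonneg (sub_nonneg.2 h)]
    exact key a b ha h

lemma aux_L (v : ℝ) (hv : 0 < v) :
    Real.log ((min v (1 / 2))⁻¹) = max (-Real.log v) (Real.log 2) := by
  rw [Real.log_inv]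
  rcases le_total v (1/2) with h | h
  · rw [min_eq_left h, max_eq_left]
    have := Real.log_le_log hv h
    rw [one_div, Real.log_inv] at this
    linarith
  · rw [min_eq_right h, max_eq_right]
    · rw [one_div, Real.log_inv, neg_neg]
    have := Real.log_le_log (by norm_num) h
    rw [one_div, Real.log_inv] at this
    linarith

lemma aux_log (u ρ θ : ℝ) (hu : 0 < u) (hρ : 0 < ρ) (hθ : 0 < θ) :
    Real.log ((min (u * ρ) (1 / 2))⁻¹) ^ (-θ) ≤
      (4 : ℝ) ^ θ * exp (θ * ρ) * Real.log ((min (u ^ 2) (1 / 2))⁻¹) ^ (-θ) := by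
  rw [aux_L _ (by positivity), aux_L _ (by positivity), Real.log_mul hu.ne' hρ.ne', Real.log_pow]
  have hl2 : (1/2 : ℝ) < Real.log 2 := by linarith [Real.log_two_gt_d9]
  set A := max (-(Real.log u + Real.log ρ)) (Real.log 2) with hA
  set B := max (-(((2:ℕ):ℝ) * Real.log u)) (Real.log 2) with hB
  have hA1 : Real.log 2 ≤ A := le_max_right _ _
  have hA2 : -(Real.log u + Real.log ρ) ≤ A := le_max_left _ _
  have hB1 : Real.log 2 ≤ B := le_max_right _ _
  have hA0 : 0 < A := by linarith
  have hB0 : 0 < B := by linarith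
  have hlρ : Real.log ρ ≤ ρ := by linarith [Real.log_le_sub_one_of_pos hρ]
  have hBA : B ≤ 4 * (1 + ρ) * A := by
    apply max_le
    · push_cast
      nlinarith [mul_le_mul_of_nonneg_left hA1 hρ.le]
    · nlinarith [mul_pos hρ hA0]
  have hBA' : B ≤ 4 * exp ρ * A := by
    refine hBA.trans ?_
    gcongr
    linarith [add_one_le_exp ρ]
  have h1 : B ^ θ ≤ (4:ℝ) ^ θ * exp (θ * ρ) * A ^ θ := by
    refine (Real.rpow_le_rpow hB0.le hBA' hθ.le).trans_eq ?_
    rw [Real.mul_rpow (by positivity) hA0.le, Real.mul_rpow (by positivity) (by positivity),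
      ← Real.exp_mul, mul_comm ρ]
  rw [Real.rpow_neg hA0.le, Real.rpow_neg hB0.le]
  have hAθ := Real.rpow_pos_of_pos hA0 θ
  have hBθ := Real.rpow_pos_of_pos hB0 θ
  rw [← div_eq_mul_inv, le_div_iff₀ hBθ, inv_mul_le_iff₀ hAθ]
  linarith

lemma aux_pt (u ρ δ θ : ℝ) (hu : 0 < u) (hρ : 0 ≤ ρ) (hδ : 0 < δ) (hθ : 0 < θ) :
    (u * ρ) ^ δ * Real.log ((min (u * ρ) (1 / 2))⁻¹) ^ (-θ) * exp (-ρ ^ 2 / 2) * (u * ρ) ≤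
      (4 : ℝ) ^ θ * exp ((1 + δ + θ) ^ 2) * (u ^ (1 + δ) *
        Real.log ((min (u ^ 2) (1 / 2))⁻¹) ^ (-θ)) * exp (-(1/4) * ρ ^ 2) := by
  have hB : 0 ≤ Real.log ((min (u ^ 2) (1 / 2))⁻¹) := by
    rw [aux_L _ (by positivity)]
    exact le_max_of_le_right (Real.log_nonneg (by norm_num))
  rcases hρ.eq_or_lt with h | h
  · subst h
    simp only [mul_zero]
    have := Real.rpow_nonneg hB (-θ)
    positivity
  have hl := aux_log u ρ θ hu h hθ
  set B := Real.log ((min (u ^ 2) (1 / 2))⁻¹) ^ (-θ) with hBdef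
  have hB' : 0 ≤ B := Real.rpow_nonneg hB _
  have hρe : ρ ≤ exp ρ := by linarith [add_one_le_exp ρ]
  have hδe : ρ ^ δ ≤ exp (δ * ρ) := by
    refine (Real.rpow_le_rpow hρ hρe hδ.le).trans_eq ?_
    rw [← Real.exp_mul, mul_comm]
  have hee : exp (δ * ρ) * exp (θ * ρ) * exp (-ρ ^ 2 / 2) * exp ρ ≤
      exp ((1 + δ + θ) ^ 2) * exp (-(1/4) * ρ ^ 2) := by
    rw [← exp_add, ← exp_add, ← exp_add, ← exp_add]
    apply exp_le_exp.2
    nlinarith [sq_nonneg ((1 + δ + θ) - ρ / 2)]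
  rw [Real.mul_rpow hu.le hρ, Real.rpow_add hu, Real.rpow_one]
  calc _ ≤ u ^ δ * exp (δ * ρ) * ((4 : ℝ) ^ θ * exp (θ * ρ) * B) * exp (-ρ ^ 2 / 2)
        * (u * exp ρ) := by
        have hA : 0 ≤ Real.log ((min (u * ρ) (1 / 2))⁻¹) ^ (-θ) := by
          apply Real.rpow_nonneg
          rw [aux_L _ (by positivity)]
          exact le_max_of_le_right (Real.log_nonneg (by norm_num))
        gcongr
    _ = (4 : ℝ) ^ θ * (u * u ^ δ * B) *
        (exp (δ * ρ) * exp (θ * ρ) * exp (-ρ ^ 2 / 2) * exp ρ) := by ring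
    _ ≤ (4 : ℝ) ^ θ * (u * u ^ δ * B) *
        (exp ((1 + δ + θ) ^ 2) * exp (-(1/4) * ρ ^ 2)) := by gcongr
    _ = _ := by ring

lemma aux_int (d : ℕ) : Integrable
    (fun z : EuclideanSpace ℝ (Fin d) => exp (-(1/4) * ‖z‖ ^ 2)) := by
  have h := GaussianFourier.integrable_cexp_neg_mul_sq_norm_add
    (V := EuclideanSpace ℝ (Fin d)) (b := 1/4) (by norm_num) 0 0
  have h2 := h.norm
  refine h2.congr (Filter.Eventually.of_forall fun z => ?_)
  simp [Complex.norm_exp, ← Complex.ofReal_pow]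

theorem stmt_17 (K : ℝ) (hK : 0 < K) (d : ℕ) (δ θ : ℝ)
    (hδ : δ ∈ Ioc (0 : ℝ) 1) (hθ : 0 < θ) :
    ∃ C > 0, ∀ (a r : EuclideanSpace ℝ (Fin d) → ℝ)
      (t : ℝ) (x : EuclideanSpace ℝ (Fin d))
      (φ : EuclideanSpace ℝ (Fin d) → ℝ),
      (∀ y z, |a y - a z| ≤
        K * ‖y - z‖ ^ δ * Real.log ((min ‖y - z‖ (1 / 2))⁻¹) ^ (-θ)) →
      (∀ y, |a y| ≤ K) →
      (∀ y, r y = Real.exp (a y)) →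
      t ∈ Ioo (0 : ℝ) 1 →
      (∀ y, φ y = (2 * π * (1 - t ^ 2)) ^ (-(d : ℝ) / 2) *
        Real.exp (-‖y - t • x‖ ^ 2 / (2 * (1 - t ^ 2)))) →
      ‖∫ y, ((r y - r (t • x)) * φ y) • (y - t • x)‖ ^ 2
        ≤ C * (1 - t ^ 2) ^ ((1 : ℝ) + δ) *
            Real.log ((min (1 - t ^ 2) (1 / 2))⁻¹) ^ (-(2 * θ)) := by
  set I := ∫ z : EuclideanSpace ℝ (Fin d), exp (-(1/4) * ‖z‖ ^ 2) with hI
  have hI0 : 0 ≤ I := integral_nonneg fun z => (exp_pos _).le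
  set M := exp K * K * ((4 : ℝ) ^ θ * exp ((1 + δ + θ) ^ 2)) * (2 * π) ^ (-(d : ℝ) / 2) with hM
  have hM0 : 0 < M := by positivity
  refine ⟨(M * I) ^ 2 + 1, by positivity, ?_⟩
  intro a r t x φ ha haK hr ht hφ
  have hs : 0 < 1 - t ^ 2 := by nlinarith [ht.1, ht.2]
  obtain ⟨u, hu, hus⟩ : ∃ u : ℝ, 0 < u ∧ 1 - t ^ 2 = u ^ 2 :=
    ⟨√(1 - t ^ 2), Real.sqrt_pos.2 hs, (Real.sq_sqrt hs.le).symm⟩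
  rw [hus] at hφ ⊢
  have hB : 0 ≤ Real.log ((min (u ^ 2) (1 / 2))⁻¹) := by
    rw [aux_L _ (by positivity)]
    exact le_max_of_le_right (Real.log_nonneg (by norm_num))
  set L := Real.log ((min (u ^ 2) (1 / 2))⁻¹) with hL
  have hLθ : 0 ≤ L ^ (-θ) := Real.rpow_nonneg hB _
  have hpref : (2 * π * u ^ 2) ^ (-(d : ℝ) / 2) = (2 * π) ^ (-(d : ℝ) / 2) * (u ^ d)⁻¹ := by
    rw [Real.mul_rpow (by positivity) (by positivity), ← Real.rpow_natCast u 2,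
      ← Real.rpow_mul hu.le, ← Real.rpow_natCast u d, ← Real.rpow_neg hu.le]
    congr 2
    push_cast; ring
  have hbound : ∀ y, ‖((r y - r (t • x)) * φ y) • (y - t • x)‖ ≤
      M * (u ^ (1 + δ) * L ^ (-θ)) * (u ^ d)⁻¹ *
        exp (-(1/4) * ‖u⁻¹ • (y - t • x)‖ ^ 2) := by
    intro y
    have hn : ‖y - t • x‖ = u * ‖u⁻¹ • (y - t • x)‖ := by
      rw [norm_smul, norm_inv, Real.norm_of_nonneg hu.le, mul_inv_cancel_left₀ hu.ne']
    have h1 : |r y - r (t • x)| ≤ exp K * (K * ‖y - t • x‖ ^ δ *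
        Real.log ((min ‖y - t • x‖ (1 / 2))⁻¹) ^ (-θ)) := by
      rw [hr, hr]
      refine (aux_exp K _ _ (le_of_abs_le (haK _)) (le_of_abs_le (haK _))).trans ?_
      gcongr
      exact ha _ _
    have h2 := aux_pt u ‖u⁻¹ • (y - t • x)‖ δ θ hu (norm_nonneg _) hδ.1 hθ
    rw [norm_smul, norm_mul, Real.norm_eq_abs, Real.norm_eq_abs, hφ, hpref,
      abs_of_nonneg (a := _ * rexp _) (by positivity)]
    rw [hn] at h1 ⊢
    set ρ := ‖u⁻¹ • (y - t • x)‖ with hρ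
    have hexp : -(u * ρ) ^ 2 / (2 * u ^ 2) = -ρ ^ 2 / 2 := by
      field_simp
    rw [hexp]
    calc _ ≤ exp K * (K * (u * ρ) ^ δ * Real.log ((min (u * ρ) (1 / 2))⁻¹) ^ (-θ)) *
          ((2 * π) ^ (-(d : ℝ) / 2) * (u ^ d)⁻¹ * exp (-ρ ^ 2 / 2)) * (u * ρ) := by gcongr
      _ = exp K * K * (2 * π) ^ (-(d : ℝ) / 2) * (u ^ d)⁻¹ * ((u * ρ) ^ δ *
          Real.log ((min (u * ρ) (1 / 2))⁻¹) ^ (-θ) * exp (-ρ ^ 2 / 2) * (u * ρ)) := by ring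
      _ ≤ _ := mul_le_mul_of_nonneg_left h2 (by positivity)
      _ = _ := by rw [hM]; ring
  have hint : Integrable (fun y : EuclideanSpace ℝ (Fin d) =>
      M * (u ^ (1 + δ) * L ^ (-θ)) * (u ^ d)⁻¹ *
        exp (-(1/4) * ‖u⁻¹ • (y - t • x)‖ ^ 2)) :=
    (((aux_int d).comp_smul (inv_ne_zero hu.ne')).comp_sub_right (t • x)).const_mul _
  have hval : ∫ y : EuclideanSpace ℝ (Fin d), exp (-(1/4) * ‖u⁻¹ • (y - t • x)‖ ^ 2)
      = u ^ d * I := by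
    rw [integral_sub_right_eq_self
      (fun y : EuclideanSpace ℝ (Fin d) => exp (-(1/4) * ‖u⁻¹ • y‖ ^ 2)) (t • x),
      Measure.integral_comp_inv_smul_of_nonneg volume
        (fun y : EuclideanSpace ℝ (Fin d) => exp (-(1/4) * ‖y‖ ^ 2)) hu.le]
    simp [hI]
  have hmain : ‖∫ y, ((r y - r (t • x)) * φ y) • (y - t • x)‖ ≤
      M * I * (u ^ (1 + δ) * L ^ (-θ)) := by
    refine (norm_integral_le_of_norm_le hint (Filter.Eventually.of_forall hbound)).trans_eq ?_
    rw [integral_const_mul, hval]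
    have : u ^ d ≠ 0 := by positivity
    field_simp
  have e1 : (u ^ 2) ^ (1 + δ) = (u ^ (1 + δ)) ^ 2 := by
    rw [← Real.rpow_natCast, ← Real.rpow_natCast, ← Real.rpow_mul hu.le, ← Real.rpow_mul hu.le,
      mul_comm]
  have e2 : L ^ (-(2 * θ)) = (L ^ (-θ)) ^ 2 := by
    rw [← Real.rpow_natCast, ← Real.rpow_mul hB]
    congr 1; push_cast; ring
  rw [e1, e2]
  calc _ ≤ (M * I * (u ^ (1 + δ) * L ^ (-θ))) ^ 2 := by gcongr
    _ = (M * I) ^ 2 * (u ^ (1 + δ)) ^ 2 * (L ^ (-θ)) ^ 2 := by ring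
    _ ≤ _ := by gcongr; linarith
end
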